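/- Let m ≥ 4 be an integer, let v_1, …, v_m be real numbers with 0 < v_1 < v_2 < ⋯ < v_m, and let A_1, …, A_m and A*_1, …, A*_m be nonnegative real numbers such that: (i) A*_m = A_m; (ii) A*_h − A_h ≤ Σ_{ℓ=h+1}^{m} A_ℓ for every h ∈ [1, m−1]; and (iii) Σ_{ℓ=h}^{m} (A*_ℓ − A_ℓ) ≤ Σ_{ℓ=h}^{m} A_ℓ for every h ∈ [1, m]. Then Σ_{h=1}^{m} v_h A*_h ≤ (1 + c_m*) · Σ_{h=1}^{m} v_h A_h. (In the buffer-management interpretation, A_h and A*_h are the numbers of v_h-packets accepted by Greedy and the optimal offline algorithm respectively, so this states that the greedy multi-queue buffer management algorithm is (1 + c_m*)-competitive for the general m-valued case with class segregation.) -/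

import Mathlib

/-- `csum v i = ∑_{j=1}^{i-1} 2^{j-1} v_{i-j}` (empty sum is 0). -/
noncomputable def csum (v : ℕ → ℝ) (i : ℕ) : ℝ :=
  ∑ j ∈ Finset.Icc 1 (i - 1), (2 : ℝ) ^ (j - 1) * v (i - j)

/-- `cval v i = c_i = (v_i + csum v i) / (v_{i+1} + csum v i)`. -/
noncomputable def cval (v : ℕ → ℝ) (i : ℕ) : ℝ :=
  (v i + csum v i) / (v (i + 1) + csum v i)

/-- `cstar v m = c_m^* = max_{1 ≤ i ≤ m-1} c_i`. -/
noncomputable def cstar (v : ℕ → ℝ) (m : ℕ) : ℝ :=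
  if hne : (Finset.Icc 1 (m - 1)).Nonempty then (Finset.Icc 1 (m - 1)).sup' hne (cval v)
  else 0

theorem csum_one (v : ℕ → ℝ) : csum v 1 = 0 := by simp [csum]

theorem csum_succ (v : ℕ → ℝ) {i : ℕ} (hi : 1 ≤ i) :
    csum v (i + 1) = v i + 2 * csum v i := by
  obtain ⟨n, rfl⟩ := Nat.exists_eq_add_of_le' hi
  simp only [csum, Nat.add_sub_cancel, ← Finset.Ico_add_one_right_eq_Icc,
    Finset.sum_Ico_eq_sum_range, Finset.mul_sum]
  rw [Finset.sum_range_succ', add_comm]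
  congr 1
  · simp
  · refine Finset.sum_congr rfl fun j _ => ?_
    rw [show 1 + (j + 1) - 1 = j + 1 by omega, show 1 + j - 1 = j by omega,
      show n + 1 + 1 - (1 + (j + 1)) = n + 1 - (1 + j) by omega, pow_succ]
    ring

theorem pos_of_increasing {m : ℕ} {v : ℕ → ℝ} (hv1 : 0 < v 1)
    (hv : ∀ i, 1 ≤ i → i < m → v i < v (i + 1)) {i : ℕ} (hi : 1 ≤ i) (him : i ≤ m) :
    0 < v i := by
  induction i, hi using Nat.le_induction with
  | base => exact hv1
  | succ n hn ih => exact (ih (by omega)).trans (hv n hn (by omega))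

theorem csum_nonneg {m : ℕ} {v : ℕ → ℝ} (hv1 : 0 < v 1)
    (hv : ∀ i, 1 ≤ i → i < m → v i < v (i + 1)) {i : ℕ} (him : i ≤ m) :
    0 ≤ csum v i := by
  refine Finset.sum_nonneg fun j hj => ?_
  rw [Finset.mem_Icc] at hj
  have := pos_of_increasing hv1 hv (i := i - j) (by omega) (by omega)
  positivity

theorem cval_lt_one {m : ℕ} {v : ℕ → ℝ} (hv1 : 0 < v 1)
    (hv : ∀ i, 1 ≤ i → i < m → v i < v (i + 1)) {i : ℕ} (hi : 1 ≤ i) (him : i < m) :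
    cval v i < 1 := by
  have h0 := csum_nonneg hv1 hv him.le
  have h1 := pos_of_increasing hv1 hv hi him.le
  have h2 := hv i hi him
  rw [cval, div_lt_one (by linarith)]
  linarith

theorem cval_le_cstar (v : ℕ → ℝ) {m i : ℕ} (hi : 1 ≤ i) (him : i < m) :
    cval v i ≤ cstar v m := by
  have hmem : i ∈ Finset.Icc 1 (m - 1) := Finset.mem_Icc.2 ⟨hi, by omega⟩
  rw [cstar, dif_pos ⟨i, hmem⟩]
  exact Finset.le_sup' (cval v) hmem

theorem cstar_le_one {m : ℕ} {v : ℕ → ℝ} (hv1 : 0 < v 1)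
    (hv : ∀ i, 1 ≤ i → i < m → v i < v (i + 1)) : cstar v m ≤ 1 := by
  unfold cstar
  split_ifs with hne
  · refine Finset.sup'_le hne _ fun i hi => ?_
    rw [Finset.mem_Icc] at hi
    exact (cval_lt_one hv1 hv hi.1 (by omega)).le
  · exact zero_le_one

theorem add_csum_le_cstar_mul {m : ℕ} {v : ℕ → ℝ} (hv1 : 0 < v 1)
    (hv : ∀ i, 1 ≤ i → i < m → v i < v (i + 1)) {i : ℕ} (hi : 1 ≤ i) (him : i < m) :
    v i + csum v i ≤ cstar v m * (v (i + 1) + csum v i) := by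
  have h0 := csum_nonneg hv1 hv him.le
  have h1 := pos_of_increasing hv1 hv (i := i + 1) (by omega) him
  exact (div_le_iff₀ (by linarith)).1 (cval_le_cstar v hi him)

theorem cstar_nonneg {m : ℕ} {v : ℕ → ℝ} (hm : 2 ≤ m) (hv1 : 0 < v 1)
    (hv : ∀ i, 1 ≤ i → i < m → v i < v (i + 1)) : 0 ≤ cstar v m := by
  refine le_trans ?_ (cval_le_cstar v (i := 1) le_rfl (by omega))
  have := pos_of_increasing hv1 hv (i := 2) (by omega) hm
  simp only [cval, csum_one, add_zero]
  positivity

/-- Invariant of the summation by parts: `S` and `T` are the tail sums of `a` and `d`. -/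
theorem partial_sum_invariant {m : ℕ} (hm : 2 ≤ m) {v a d S T : ℕ → ℝ} (hv1 : 0 < v 1)
    (hv : ∀ i, 1 ≤ i → i < m → v i < v (i + 1))
    (hS : ∀ i, i ≤ m → S i = a i + S (i + 1)) (hT : ∀ i, i ≤ m → T i = d i + T (i + 1))
    (hd : ∀ i, 1 ≤ i → i < m → d i ≤ S (i + 1)) (hTS : ∀ i, 1 ≤ i → i ≤ m → T i ≤ S i)
    {k : ℕ} (hk : 1 ≤ k) (hkm : k ≤ m) :
    0 ≤ ∑ h ∈ Finset.Icc 1 k, v h * (cstar v m * a h - d h)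
      + v k * (cstar v m * S (k + 1) - T (k + 1))
      + (1 - cstar v m) * (v k + csum v k) * T k := by
  induction k, hk using Nat.le_induction with
  | base =>
    have h1 := hS 1 hkm
    have h2 := hT 1 hkm
    have h3 := mul_nonneg (mul_nonneg hv1.le (cstar_nonneg hm hv1 hv))
      (sub_nonneg.2 (hTS 1 le_rfl hkm))
    simp only [Finset.Icc_self, Finset.sum_singleton, csum_one]
    rw [h1, h2] at h3
    rw [h2]
    linarith
  | succ n hn ih =>
    have hnm : n < m := hkm
    have ih := ih hnm.le
    have h1 := hS (n + 1) hkm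
    have h2 := hT (n + 1) hkm
    have h3 := hT n hnm.le
    have hQ : 0 ≤ v n + csum v n :=
      add_nonneg (pos_of_increasing hv1 hv hn hnm.le).le (csum_nonneg hv1 hv hnm.le)
    have h4 := mul_nonneg (mul_nonneg (sub_nonneg.2 (cstar_le_one hv1 hv)) hQ)
      (sub_nonneg.2 (hd n hn hnm))
    have h5 := mul_nonneg (sub_nonneg.2 (add_csum_le_cstar_mul hv1 hv hn hnm))
      (sub_nonneg.2 (hTS (n + 1) (by omega) hkm))
    rw [Finset.sum_Icc_succ_top (by omega), csum_succ v hn]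
    rw [h3] at ih
    rw [h1, h2] at ih h5
    rw [h1] at h4
    rw [h2]
    linarith

/-- Theorem 4.5 (main theorem): let `m ≥ 4`, `0 < v 1 < ⋯ < v m`, and let
`A_1, …, A_m` (packets accepted by Greedy) and `A*_1, …, A*_m` (packets accepted by the
optimal offline algorithm) be nonnegative reals with (i) `A*_m = A_m`, (ii)
`A*_h - A_h ≤ ∑_{ℓ=h+1}^{m} A_ℓ` for every `h ∈ [1, m-1]`, and (iii)
`∑_{ℓ=h}^{m} (A*_ℓ - A_ℓ) ≤ ∑_{ℓ=h}^{m} A_ℓ` for every `h ∈ [1, m]`. Then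
`∑_{h=1}^{m} v_h A*_h ≤ (1 + c_m^*) ∑_{h=1}^{m} v_h A_h`, i.e. Greedy is
`(1 + c_m^*)`-competitive for the general `m`-valued case with class segregation. -/
theorem stmt9 (m : ℕ) (hm : 4 ≤ m) (v A As : ℕ → ℝ)
    (hv1 : 0 < v 1) (hv : ∀ i, 1 ≤ i → i < m → v i < v (i + 1))
    (hA : ∀ i ∈ Finset.Icc 1 m, 0 ≤ A i) (hAs : ∀ i ∈ Finset.Icc 1 m, 0 ≤ As i)
    (h1 : As m = A m)
    (h2 : ∀ h ∈ Finset.Icc 1 (m - 1), As h - A h ≤ ∑ ℓ ∈ Finset.Icc (h + 1) m, A ℓ)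
    (h3 : ∀ h ∈ Finset.Icc 1 m,
      ∑ ℓ ∈ Finset.Icc h m, (As ℓ - A ℓ) ≤ ∑ ℓ ∈ Finset.Icc h m, A ℓ) :
    ∑ h ∈ Finset.Icc 1 m, v h * As h ≤
      (1 + cstar v m) * ∑ h ∈ Finset.Icc 1 m, v h * A h := by
  have tail (f : ℕ → ℝ) (i : ℕ) (hi : i ≤ m) :
      ∑ ℓ ∈ Finset.Icc i m, f ℓ = f i + ∑ ℓ ∈ Finset.Icc (i + 1) m, f ℓ := by
    simpa [Finset.Ico_add_one_right_eq_Icc] using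
      Finset.sum_eq_sum_Ico_succ_bot (Nat.lt_succ_of_le hi) f
  have key := partial_sum_invariant (m := m) (v := v) (a := A) (d := fun i => As i - A i)
    (S := fun i => ∑ ℓ ∈ Finset.Icc i m, A ℓ)
    (T := fun i => ∑ ℓ ∈ Finset.Icc i m, (As ℓ - A ℓ)) (by omega) hv1 hv
    (tail A) (tail _)
    (fun i hi him => h2 i (Finset.mem_Icc.2 ⟨hi, by omega⟩))
    (fun i hi him => h3 i (Finset.mem_Icc.2 ⟨hi, him⟩)) (k := m) (by omega) le_rfl
  simp only [Finset.Icc_self, Finset.sum_singleton, h1, sub_self, mul_zero, add_zero,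
    Finset.Icc_eq_empty_of_lt (Nat.lt_succ_self m), Finset.sum_empty] at key
  rw [← sub_nonneg, Finset.mul_sum, ← Finset.sum_sub_distrib]
  refine key.trans_eq (Finset.sum_congr rfl fun h _ => ?_)
  ring
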